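/- Let G be an s-t graph in which every vertex and edge lies on some s-t path, with a feedback vertex set S of size at most 2k, and suppose G admits a tracking set of size at most k. Then for each vertex f ∈ S, the number of vertices of the forest G − S that lie in trees forming tree-sink structures with f as sink (i.e., vertices adjacent to f that share f as neighbor with another vertex of the same tree, together forming such structures) is at most 3k. -/

import Mathlib

/-- A tracking set for an s-t graph: any two distinct s-t paths yield different
sequences of vertices of `T`. -/
def IsTrackingSet {V : Type*} [DecidableEq V] (G : SimpleGraph V) (s t : V)
    (T : Finset V) : Prop :=
  ∀ p q : G.Path s t,
    p.1.support.filter (· ∈ T) = q.1.support.filter (· ∈ T) → p = q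

namespace SimpleGraph

variable {V : Type*} {G F : SimpleGraph V}

namespace Walk

lemma IsPath.eq_of_mem_append {a b c x : V} {p : G.Walk a b} {q : G.Walk b c}
    (h : (p.append q).IsPath) (hp : x ∈ p.support) (hq : x ∈ q.support) : x = b := by
  by_contra hx
  rw [isPath_def, support_append] at h
  have hq' : x ∈ q.support.tail := by
    rw [mem_support_iff] at hq
    exact hq.resolve_left hx
  exact List.disjoint_of_nodup_append h hp hq'

lemma IsPath.append {a b c : V} {p : G.Walk a b} {q : G.Walk b c} (hp : p.IsPath)
    (hq : q.IsPath) (h : ∀ x ∈ p.support, x ∈ q.support → x = b) : (p.append q).IsPath := by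
  rw [isPath_def, support_append, List.nodup_append']
  refine ⟨hp.support_nodup, hq.support_nodup.tail, fun x hx hx' => ?_⟩
  have hq' := hq.support_nodup
  rw [← cons_tail_support, List.nodup_cons] at hq'
  exact hq'.1 (h x hx (List.mem_of_mem_tail hx') ▸ hx')

/-- A walk meeting a set splits at its first vertex in this set. -/
lemma exists_append_first_mem {a b x : V} (P : G.Walk a b) {H : Set V} (hx : x ∈ P.support)
    (hxH : x ∈ H) : ∃ p ∈ H, ∃ (W : G.Walk a p) (R : G.Walk p b), P = W.append R ∧
      ∀ y ∈ W.support, y ∈ H → y = p := by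
  induction P with
  | nil =>
    obtain rfl : x = _ := by simpa using hx
    exact ⟨x, hxH, Walk.nil, Walk.nil, rfl, by simp⟩
  | @cons u v w h P ih =>
    by_cases hu : u ∈ H
    · exact ⟨u, hu, Walk.nil, Walk.cons h P, rfl, by simp⟩
    · have hx' : x ∈ P.support := by
        rw [support_cons, List.mem_cons] at hx
        exact hx.resolve_left fun e => hu (e ▸ hxH)
      obtain ⟨p, hp, W, R, rfl, hW⟩ := ih hx'
      refine ⟨p, hp, Walk.cons h W, R, rfl, fun y hy hyH => ?_⟩
      rw [support_cons, List.mem_cons] at hy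
      rcases hy with rfl | hy
      · exact absurd hyH hu
      · exact hW y hy hyH

lemma IsPath.exists_filter_support_eq_of_head? (D : V → Prop) [DecidablePred D] {a b x : V}
    {r : G.Walk a b} (hr : r.IsPath) (hx : (r.support.filter D).head? = some x) :
    ∃ r' : G.Walk x b, r'.IsPath ∧ r.support.filter D = r'.support.filter D := by
  induction r with
  | @nil u =>
    by_cases hu : D u
    · obtain rfl : u = x := by simpa [hu] using hx
      exact ⟨Walk.nil, IsPath.nil, rfl⟩
    · simp [hu] at hx
  | @cons u v w h P ih =>
    by_cases hu : D u
    · obtain rfl : u = x := by simpa [hu] using hx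
      exact ⟨Walk.cons h P, hr, rfl⟩
    · have hf : (Walk.cons h P).support.filter D = P.support.filter D := by simp [hu]
      rw [hf] at hx ⊢
      exact ih hr.of_cons hx

end Walk

open Walk

lemma IsAcyclic.walk_eq (hF : F.IsAcyclic) {a b : V} {p q : F.Walk a b} (hp : p.IsPath)
    (hq : q.IsPath) : p = q :=
  congrArg Subtype.val ((hF.subsingleton_path a b).elim ⟨p, hp⟩ ⟨q, hq⟩)

/-- The vertices `a` and `b` are joined by a walk with all its vertices in `A`. -/
def JoinedIn (G : SimpleGraph V) (A : Set V) (a b : V) : Prop :=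
  ∃ w : G.Walk a b, ∀ x ∈ w.support, x ∈ A

lemma Walk.joinedIn {a b : V} (w : G.Walk a b) : G.JoinedIn {x | x ∈ w.support} a b :=
  ⟨w, fun _ h => h⟩

lemma JoinedIn.symm {A : Set V} {a b : V} (h : G.JoinedIn A a b) : G.JoinedIn A b a := by
  obtain ⟨w, hw⟩ := h
  exact ⟨w.reverse, by simpa using hw⟩

lemma JoinedIn.mono {A B : Set V} {a b : V} (h : G.JoinedIn A a b) (hAB : A ⊆ B) :
    G.JoinedIn B a b :=
  h.imp fun _ hw x hx => hAB (hw x hx)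

lemma JoinedIn.mapLe {A : Set V} {a b : V} (h : F.JoinedIn A a b) (hFG : F ≤ G) :
    G.JoinedIn A a b := by
  obtain ⟨w, hw⟩ := h
  exact ⟨w.mapLe hFG, by simpa using hw⟩

lemma JoinedIn.trans {A B : Set V} {a b c : V} (h : G.JoinedIn A a b) (h' : G.JoinedIn B b c) :
    G.JoinedIn (A ∪ B) a c := by
  obtain ⟨w, hw⟩ := h
  obtain ⟨w', hw'⟩ := h'
  refine ⟨w.append w', fun x hx => ?_⟩
  rw [mem_support_append_iff] at hx
  exact hx.imp (hw x) (hw' x)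

lemma JoinedIn.trans_adj {A : Set V} {a b c : V} (h : G.JoinedIn A a b) (h' : G.Adj b c) :
    G.JoinedIn (A ∪ {c}) a c := by
  obtain ⟨w, hw⟩ := h
  refine ⟨w.append (cons h' nil), fun x hx => ?_⟩
  rw [mem_support_append_iff] at hx
  rcases hx with hx | hx
  · exact Or.inl (hw x hx)
  · simp only [support_cons, support_nil, List.mem_cons, List.not_mem_nil, or_false] at hx
    rcases hx with rfl | rfl
    · exact Or.inl (hw _ w.end_mem_support)
    · exact Or.inr rfl

lemma JoinedIn.right_mem {A : Set V} {a b : V} (h : G.JoinedIn A a b) : b ∈ A := by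
  obtain ⟨w, hw⟩ := h
  exact hw _ w.end_mem_support

lemma JoinedIn.left_mem {A : Set V} {a b : V} (h : G.JoinedIn A a b) : a ∈ A :=
  h.symm.right_mem

lemma JoinedIn.exists_isPath {A : Set V} {a b : V} (h : G.JoinedIn A a b) :
    ∃ w : G.Walk a b, w.IsPath ∧ ∀ x ∈ w.support, x ∈ A := by
  classical
  obtain ⟨w, hw⟩ := h
  exact ⟨w.bypass, w.bypass_isPath, fun x hx => hw x (w.support_bypass_subset_support hx)⟩

variable {s t f : V}

/-- Up to reversal, a path passes through one of two given vertices on it first. -/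
lemma Walk.IsPath.exists_split {D : V → Prop} {a b p q : V} {L : F.Walk a b} (hL : L.IsPath)
    (ha : D a) (hb : D b) (hp : p ∈ L.support) (hq : q ∈ L.support) :
    ∃ (a b : V) (L₁ : F.Walk a p) (L₂ : F.Walk p q) (L₃ : F.Walk q b),
      (L₁.append (L₂.append L₃)).IsPath ∧ D a ∧ D b ∧
      ∀ x, x ∈ L.support ↔ x ∈ L₁.support ∨ x ∈ L₂.support ∨ x ∈ L₃.support := by
  obtain ⟨L₁, R, h1, h2, rfl⟩ := hL.mem_support_iff_exists_append.1 hp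
  rw [mem_support_append_iff] at hq
  rcases hq with hq | hq
  · obtain ⟨L₀, L₂, h3, h4, rfl⟩ := h1.mem_support_iff_exists_append.1 hq
    refine ⟨b, a, R.reverse, L₂.reverse, L₀.reverse, ?_, hb, ha, fun x => ?_⟩
    · rw [← reverse_append, ← reverse_append]
      exact hL.reverse
    · simp only [mem_support_append_iff, support_reverse, List.mem_reverse]
      tauto
  · obtain ⟨L₂, L₃, h3, h4, rfl⟩ := h2.mem_support_iff_exists_append.1 hq
    refine ⟨a, b, L₁, L₂, L₃, hL, ha, hb, fun x => ?_⟩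
    simp only [mem_support_append_iff]

/-- The vertices `p, q` of `H` are attached to `s` and `t` by disjoint sets meeting `H` only in
`p` and `q`. -/
structure IsLinkage (G : SimpleGraph V) (s t : V) (H A B : Set V) (p q : V) : Prop where
  ne : p ≠ q
  left_mem : p ∈ H
  right_mem : q ∈ H
  left : G.JoinedIn A s p
  right : G.JoinedIn B q t
  disjoint : ∀ x ∈ A, x ∉ B
  eq_left : ∀ x ∈ H, x ∈ A → x = p
  eq_right : ∀ x ∈ H, x ∈ B → x = q
  left_of_mem : ∀ x ∈ A, x ≠ p → G.JoinedIn (A \ {p}) s x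
  right_of_mem : ∀ x ∈ B, x ≠ q → G.JoinedIn (B \ {q}) x t

lemma IsLinkage.symm {H A B : Set V} {p q : V} (h : G.IsLinkage s t H A B p q) :
    G.IsLinkage t s H B A q p :=
  ⟨h.ne.symm, h.right_mem, h.left_mem, h.right.symm, h.left.symm,
    fun x hB hA => h.disjoint x hA hB, h.eq_right, h.eq_left,
    fun x hx hne => (h.right_of_mem x hx hne).symm, fun x hx hne => (h.left_of_mem x hx hne).symm⟩

lemma Walk.IsPath.joinedIn_sdiff {a b x : V} {W : G.Walk a b} (hW : W.IsPath)
    (hx : x ∈ W.support) (hxb : x ≠ b) : G.JoinedIn ({y | y ∈ W.support} \ {b}) a x := by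
  classical
  refine ⟨W.takeUntil x hx, fun y hy => ⟨W.support_takeUntil_subset_support hx hy, ?_⟩⟩
  rintro rfl
  exact endpoint_notMem_support_takeUntil hW hx hxb.symm hy

lemma exists_isLinkage {P : G.Walk s t} (hP : P.IsPath) {H : Set V} {x y : V}
    (hx : x ∈ P.support) (hy : y ∈ P.support) (hxH : x ∈ H) (hyH : y ∈ H) (hxy : x ≠ y) :
    ∃ A B p q, G.IsLinkage s t H A B p q := by
  obtain ⟨p, hp, W, R, rfl, hW⟩ := P.exists_append_first_mem hx hxH
  obtain ⟨q, hq, E, M, hE, hEH⟩ :=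
    R.reverse.exists_append_first_mem (x := p) (by simp) hp
  have hER : ∀ z ∈ E.support, z ∈ R.support := by
    intro z hz
    rw [← List.mem_reverse, ← support_reverse, hE, mem_support_append_iff]
    exact Or.inl hz
  have hR : R.reverse.IsPath := hP.of_append_right.reverse
  rw [hE] at hR
  have hEp : E.IsPath := hR.of_append_left
  have hne : p ≠ q := by
    rintro rfl
    have hM : M = nil := by
      exact eq_nil_iff_nil.2 (isPath_iff_nil.1 hR.of_append_right)
    have hall : ∀ z ∈ (W.append R).support, z ∈ H → z = p := by
      intro z hz hzH
      rw [mem_support_append_iff] at hz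
      rcases hz with hz | hz
      · exact hW z hz hzH
      · refine hEH z ?_ hzH
        rw [← List.mem_reverse, ← support_reverse, hE, hM, append_nil] at hz
        exact hz
    exact hxy ((hall x hx hxH).trans (hall y hy hyH).symm)
  refine ⟨_, _, p, q, hne, hp, hq, W.joinedIn, E.joinedIn.symm, ?_, fun z hz hz' => hW z hz' hz,
    fun z hz hz' => hEH z hz' hz,
    fun z hz hne => hP.of_append_left.joinedIn_sdiff hz hne,
    fun z hz hne => (hEp.joinedIn_sdiff hz hne).symm⟩
  intro z hzW hzE
  obtain rfl := hP.eq_of_mem_append hzW (hER z hzE)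
  exact hne (hEH z hzE hp)

lemma isAcyclic_spanningCoe_induce {S : Set V} (h : (G.induce S).IsAcyclic) :
    (G.induce S).spanningCoe.IsAcyclic := by
  intro v c hc
  have hS : ∀ {x y : V} (w : (G.induce S).spanningCoe.Walk x y), y ∈ S →
      ∀ z ∈ w.support, z ∈ S := by
    intro x y w hy
    induction w with
    | nil => simpa using hy
    | cons h w ih =>
      intro z hz
      rw [support_cons, List.mem_cons] at hz
      rcases hz with rfl | hz
      · rw [map_adj] at h
        obtain ⟨a, b, -, rfl, -⟩ := h
        exact a.2
      · exact ih hy z hz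
  have hv : v ∈ S := by
    cases c with
    | nil => exact absurd hc (by simp)
    | cons h w =>
      rw [map_adj] at h
      obtain ⟨a, b, -, rfl, -⟩ := h
      exact a.2
  have h' : ((G.induce S).spanningCoe.induce S).IsAcyclic := by rwa [induce_spanningCoe]
  refine h' (c.induce S (hS c hv)) ?_
  rw [← isCycle_map_iff_of_injective (f := (Embedding.induce S).toHom) Subtype.val_injective,
    map_induce]
  exact hc

variable [DecidableEq V] {T : Finset V}

lemma _root_.IsTrackingSet.symm (h : IsTrackingSet G s t T) : IsTrackingSet G t s T := by
  intro p q hpq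
  have := h ⟨p.1.reverse, p.2.reverse⟩ ⟨q.1.reverse, q.2.reverse⟩ (by
    simp only [support_reverse, List.filter_reverse, hpq])
  apply Subtype.ext
  have h' := congrArg (fun r : G.Path s t => r.1.reverse) this
  simpa using h'

/-- Two parallel paths that can be extended to `s`-`t` paths and meet the tracking set in the
same sequence are equal. -/
lemma _root_.IsTrackingSet.eq_of_filter_eq (hT : IsTrackingSet G s t T) {a b : V}
    {A B : Set V} (hA : G.JoinedIn A s a) (hB : G.JoinedIn B b t) (hAB : ∀ x ∈ A, x ∉ B)
    {D D' : G.Walk a b} (hD : D.IsPath) (hD' : D'.IsPath)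
    (hDA : ∀ x ∈ D.support, x ∈ A → x = a) (hDB : ∀ x ∈ D.support, x ∈ B → x = b)
    (hDA' : ∀ x ∈ D'.support, x ∈ A → x = a) (hDB' : ∀ x ∈ D'.support, x ∈ B → x = b)
    (hfil : D.support.filter (· ∈ T) = D'.support.filter (· ∈ T)) : D = D' := by
  obtain ⟨W, hW, hWA⟩ := hA.exists_isPath
  obtain ⟨E, hE, hEB⟩ := hB.exists_isPath
  have key : ∀ D : G.Walk a b, D.IsPath → (∀ x ∈ D.support, x ∈ A → x = a) →
      (∀ x ∈ D.support, x ∈ B → x = b) → (W.append (D.append E)).IsPath := by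
    intro D hD h1 h2
    refine hW.append (hD.append hE fun x hx hx' => h2 x hx (hEB x hx')) fun x hx hx' => ?_
    rw [mem_support_append_iff] at hx'
    exact hx'.elim (fun h => h1 x h (hWA x hx)) fun h => absurd (hEB x h) (hAB x (hWA x hx))
  have hs : ∀ D : G.Walk a b, (W.append (D.append E)).support =
      W.support.dropLast ++ (D.support ++ E.support.tail) := by
    intro D
    rw [support_append_eq_support_dropLast_append, support_append]
  have heq := hT ⟨_, key D hD hDA hDB⟩ ⟨_, key D' hD' hDA' hDB'⟩ (by
    simp only [hs, List.filter_append, hfil])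
  have h := congrArg (fun p : G.Path s t => p.1.support) heq
  simp only [hs] at h
  exact ext_support (List.append_cancel_right (List.append_cancel_left h))

/-- Paths of a forest leading from neighbors of `f` to `q` can be told apart by the first tracker
on them. -/
lemma _root_.IsTrackingSet.card_le_of_forall_path (hT : IsTrackingSet G s t T) (hFG : F ≤ G)
    (hF : F.IsAcyclic) {q : V} {A B : Set V} (hA : G.JoinedIn A s f) (hB : G.JoinedIn B q t)
    (hAB : ∀ x ∈ A, x ∉ B) {N U : Finset V}
    (hN : ∀ v ∈ N, G.Adj f v ∧ ∃ r : F.Walk v q, r.IsPath ∧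
      ∀ x ∈ r.support, x ∉ A ∧ (x ∈ B → x = q) ∧ (x ∈ T → x ∈ U)) :
    N.card ≤ U.card + 1 := by
  classical
  choose! hadj hN using hN
  have hex : ∀ v ∈ N, ∃ o : Option V, ∃ r : F.Walk v q, r.IsPath ∧
      (∀ x ∈ r.support, x ∉ A ∧ (x ∈ B → x = q) ∧ (x ∈ T → x ∈ U)) ∧
      (r.support.filter (· ∈ T)).head? = o := by
    intro v hv
    obtain ⟨r, hr, hrx⟩ := hN v hv
    exact ⟨_, r, hr, hrx, rfl⟩
  choose! g hg using hex
  have hmaps : ∀ v ∈ N, g v ∈ U.insertNone := by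
    intro v hv
    obtain ⟨r, hr, hrx, hgv⟩ := hg v hv
    rw [Finset.mem_insertNone]
    intro x hx
    rw [← hgv] at hx
    have := List.mem_of_mem_head? hx
    rw [List.mem_filter] at this
    exact (hrx x this.1).2.2 (by simpa using this.2)
  have hinj : Set.InjOn g N := by
    intro v hv v' hv' hgg
    obtain ⟨r, hr, hrx, hgv⟩ := hg v hv
    obtain ⟨r', hr', hrx', hgv'⟩ := hg v' hv'
    have hfil : r.support.filter (· ∈ T) = r'.support.filter (· ∈ T) := by
      rw [← hgg] at hgv'
      rcases hx : g v with _ | x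
      · rw [hx] at hgv hgv'
        rw [List.head?_eq_none_iff.1 hgv, List.head?_eq_none_iff.1 hgv']
      · rw [hx] at hgv hgv'
        obtain ⟨r1, h1, e1⟩ := hr.exists_filter_support_eq_of_head? (· ∈ T) hgv
        obtain ⟨r2, h2, e2⟩ := hr'.exists_filter_support_eq_of_head? (· ∈ T) hgv'
        rw [e1, e2, hF.walk_eq h1 h2]
    have hfA := hA.right_mem
    have hpath : ∀ {v} (h : G.Adj f v) (r : F.Walk v q), r.IsPath → (∀ x ∈ r.support, x ∉ A) →
        (cons h (r.mapLe hFG)).IsPath := by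
      intro v h r hr hrA
      refine IsPath.cons ((isPath_mapLe hFG).2 hr) ?_
      rw [support_mapLe_eq_support]
      exact fun hf => hrA f hf hfA
    have hside : ∀ {v} (h : G.Adj f v) (r : F.Walk v q),
        (∀ x ∈ r.support, x ∉ A ∧ (x ∈ B → x = q) ∧ (x ∈ T → x ∈ U)) →
        ∀ x ∈ (cons h (r.mapLe hFG)).support, (x ∈ A → x = f) ∧ (x ∈ B → x = q) := by
      intro v h r hrx x hx
      rw [support_cons, List.mem_cons, support_mapLe_eq_support] at hx
      rcases hx with rfl | hx
      · exact ⟨fun _ => rfl, fun hB => absurd hB (hAB _ hfA)⟩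
      · exact ⟨fun hA => absurd hA (hrx x hx).1, (hrx x hx).2.1⟩
    have := hT.eq_of_filter_eq hA hB hAB (hpath (hadj v hv) r hr fun x hx => (hrx x hx).1)
      (hpath (hadj v' hv') r' hr' fun x hx => (hrx' x hx).1)
      (fun x hx => (hside _ r hrx x hx).1) (fun x hx => (hside _ r hrx x hx).2)
      (fun x hx => (hside _ r' hrx' x hx).1) (fun x hx => (hside _ r' hrx' x hx).2)
      (by simp only [support_cons, support_mapLe_eq_support, List.filter_cons, hfil])
    have h2 := congrArg (fun w : G.Walk f q => w.support.tail.head?) this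
    simp only [support_cons, List.tail_cons, support_mapLe_eq_support] at h2
    rw [← r.cons_tail_support, ← r'.cons_tail_support] at h2
    exact Option.some.inj h2
  calc N.card ≤ U.insertNone.card := Finset.card_le_card_of_injOn g hmaps hinj
    _ = U.card + 1 := Finset.card_insertNone U

/-- The vertices on the paths of `F` between elements of `N`. -/
def pathHull (F : SimpleGraph V) (N : Finset V) : Set V :=
  {w | ∃ l ∈ N, ∃ l' ∈ N, ∃ r : F.Walk l l', r.IsPath ∧ w ∈ r.support}

lemma exists_append_isPath_of_mem_pathHull (hF : F.IsAcyclic) {N : Finset V} {p q : V}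
    (hp : p ∈ F.pathHull N) {r : F.Walk p q} (hr : r.IsPath) :
    ∃ l ∈ N, ∃ r' : F.Walk l p, (r'.append r).IsPath ∧ ∀ x ∈ r'.support, x ∈ F.pathHull N := by
  obtain ⟨l, hl, l', hl', L, hL, hpL⟩ := hp
  obtain ⟨L₁, L₂, h1, h2, rfl⟩ := hL.mem_support_iff_exists_append.1 hpL
  have hsub : ∀ x ∈ (L₁.append L₂).support, x ∈ F.pathHull N :=
    fun x hx => ⟨l, hl, l', hl', _, hL, hx⟩
  by_cases h : (L₁.append r).IsPath
  · exact ⟨l, hl, L₁, h, fun x hx => hsub x (by simp [hx])⟩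
  refine ⟨l', hl', L₂.reverse, h2.reverse.append hr fun y hy hyr => ?_,
    fun x hx => hsub x (by simpa using Or.inr hx)⟩
  rw [support_reverse, List.mem_reverse] at hy
  by_contra hyp
  refine h (h1.append hr fun x hx hxr => ?_)
  by_contra hxp
  cases r with
  | nil => exact hyp (by simpa using hyr)
  | @cons _ c _ hc r =>
    have hcp : c ≠ p := hc.ne'
    have key : ∀ {d z} (K : F.Walk p d), K.IsPath → z ∈ K.support → z ∈ (cons hc r).support →
        z ≠ p → c ∈ K.support := by
      intro d z K hK hzK hz hzp
      obtain ⟨K₁, K₂, h1, -, rfl⟩ := hK.mem_support_iff_exists_append.1 hzK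
      obtain ⟨r₁, r₂, h2, -, he⟩ := hr.mem_support_iff_exists_append.1 hz
      rw [mem_support_append_iff, hF.walk_eq h1 h2]
      cases r₁ with
      | nil => exact absurd rfl hzp
      | cons h' r₁ =>
        rw [cons_append] at he
        injection he with _ he
        subst he
        simp
    have hc1 := key L₁.reverse h1.reverse (by simpa using hx) hxr hxp
    have hc2 := key L₂ h2 hy hyr hyp
    rw [support_reverse, List.mem_reverse] at hc1
    exact hcp (hL.eq_of_mem_append hc1 hc2)

lemma Walk.IsPath.mem_pathHull (hF : F.IsAcyclic) {N : Finset V} {v q : V}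
    (hv : v ∈ N) (hq : q ∈ F.pathHull N) {r : F.Walk v q} (hr : r.IsPath) :
    ∀ x ∈ r.support, x ∈ F.pathHull N := by
  obtain ⟨l, hl, r', hr', -⟩ := exists_append_isPath_of_mem_pathHull hF hq hr.reverse
  exact fun x hx => ⟨l, hl, v, hv, _, hr', by simp [hx]⟩

/-- A path of `F` without trackers that closes up to a cycle through `f`. -/
structure IsLoop (G : SimpleGraph V) (T : Finset V) (f : V) {a b : V} (L : F.Walk a b) :
    Prop where
  isPath : L.IsPath
  ne : a ≠ b
  adj_left : G.Adj f a
  adj_right : G.Adj f b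
  notMem : ∀ x ∈ L.support, x ∉ T
  apex_notMem : f ∉ L.support

lemma IsLoop.not_joinedIn (hT : IsTrackingSet G s t T) (hFG : F ≤ G) (hF : F.IsAcyclic)
    {a b z : V} {L : F.Walk a b} (hL : IsLoop G T f L) (hz : z ∈ L.support) {A B : Set V}
    (hA : G.JoinedIn A s f) (hB : G.JoinedIn B z t) (hAB : ∀ x ∈ A, x ∉ B)
    (hLA : ∀ x ∈ L.support, x ∉ A) (hLB : ∀ x ∈ L.support, x ∈ B → x = z) : False := by
  have hsub := L.support_takeUntil_subset_support hz
  have hsub' := L.support_dropUntil_subset_support hz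
  have := hT.card_le_of_forall_path hFG hF hA hB hAB (N := {a, b}) (U := ∅) (by
    intro v hv
    rw [Finset.mem_insert, Finset.mem_singleton] at hv
    rcases hv with rfl | rfl
    · refine ⟨hL.adj_left, L.takeUntil z hz, hL.isPath.takeUntil hz, fun x hx => ?_⟩
      exact ⟨hLA x (hsub hx), hLB x (hsub hx), fun h => absurd h (hL.notMem x (hsub hx))⟩
    · refine ⟨hL.adj_right, (L.dropUntil z hz).reverse, (hL.isPath.dropUntil hz).reverse,
        fun x hx => ?_⟩
      rw [support_reverse, List.mem_reverse] at hx
      exact ⟨hLA x (hsub' hx), hLB x (hsub' hx), fun h => absurd h (hL.notMem x (hsub' hx))⟩)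
  rw [Finset.card_pair hL.ne] at this
  simp at this

lemma IsLoop.not_joinedIn_of_disjoint (hT : IsTrackingSet G s t T) (hFG : F ≤ G)
    (hF : F.IsAcyclic) {a b a' b' p q : V} {L : F.Walk a b} {L' : F.Walk a' b'}
    (hL : IsLoop G T f L) (hL' : IsLoop G T f L') (hLL : ∀ x ∈ L.support, x ∉ L'.support)
    (hp : p ∈ L.support) (hq : q ∈ L'.support) {A B : Set V} (hA : G.JoinedIn A s p)
    (hB : G.JoinedIn B q t) (hAB : ∀ x ∈ A, x ∉ B) (hA' : ∀ x ∈ L'.support, x ∉ A)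
    (hBL : ∀ x ∈ L.support, x ∉ B) (hBL' : ∀ x ∈ L'.support, x ∈ B → x = q) (hf : f ∉ B) :
    False := by
  have h1 := (L.takeUntil p hp).reverse.joinedIn.mono (B := {x | x ∈ L.support}) (by
    intro x hx
    simp only [support_reverse, List.mem_reverse, Set.mem_ofPred_eq] at hx
    exact L.support_takeUntil_subset_support hp hx)
  have h2 := (hA.trans (h1.mapLe hFG)).trans_adj hL.adj_left.symm
  refine hL'.not_joinedIn hT hFG hF hq h2 hB ?_ ?_ hBL'
  · rintro x ((hx | hx) | rfl)
    · exact hAB x hx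
    · exact hBL x hx
    · exact hf
  · rintro x hx ((hxA | hxL) | rfl)
    · exact hA' x hx hxA
    · exact hLL x hxL hx
    · exact hL'.apex_notMem hx

lemma IsLoop.apex_mem (hT : IsTrackingSet G s t T) (hFG : F ≤ G) (hF : F.IsAcyclic)
    {a b p q : V} {L : F.Walk a b} (hL : IsLoop G T f L) {A B : Set V}
    (h : G.IsLinkage s t (insert f {x | x ∈ L.support}) A B p q) : f ∈ T := by
  by_contra hf
  have hfL := hL.apex_notMem
  rcases h.left_mem with rfl | hp
  · have hq : q ∈ L.support := h.right_mem.resolve_left h.ne.symm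
    refine hL.not_joinedIn hT hFG hF hq h.left h.right h.disjoint (fun x hx hxA => ?_)
      fun x hx => h.eq_right x (Or.inr hx)
    exact hfL (h.eq_left x (Or.inr hx) hxA ▸ hx)
  rcases h.right_mem with rfl | hq
  · refine hL.not_joinedIn hT.symm hFG hF hp h.symm.left h.symm.right h.symm.disjoint
      (fun x hx hxA => ?_) fun x hx => h.eq_left x (Or.inr hx)
    exact hfL (h.eq_right x (Or.inr hx) hxA ▸ hx)
  obtain ⟨a', b', L₁, L₂, L₃, hpath, ha, hb, hmem⟩ :=
    hL.isPath.exists_split hL.adj_left hL.adj_right hp hq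
  have h23 := hpath.of_append_right
  have hf1 : f ∉ L₁.support := fun h => hfL ((hmem f).2 (Or.inl h))
  have hf2 : f ∉ L₂.support := fun h => hfL ((hmem f).2 (Or.inr (Or.inl h)))
  have hf3 : f ∉ L₃.support := fun h => hfL ((hmem f).2 (Or.inr (Or.inr h)))
  have hq1 : ∀ x ∈ L₁.support, x ∉ L₃.support := by
    intro x hx hx3
    obtain rfl := hpath.eq_of_mem_append hx (by simp [hx3])
    exact h.ne (h23.eq_of_mem_append L₂.start_mem_support hx3)
  let D' : G.Walk p q :=
    (L₁.reverse.mapLe hFG).append (cons ha.symm (cons hb (L₃.reverse.mapLe hFG)))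
  have hD' : D'.IsPath := by
    refine IsPath.append ?_ ?_ ?_
    · exact (isPath_mapLe hFG).2 hpath.of_append_left.reverse
    · refine IsPath.cons (IsPath.cons ((isPath_mapLe hFG).2 h23.of_append_right.reverse) ?_) ?_
      · simpa [support_mapLe_eq_support] using hf3
      · have := hq1 a' L₁.start_mem_support
        have h' := ha.ne'
        simp [this, h']
    · intro x hx hx'
      simp only [support_mapLe_eq_support, support_reverse, List.mem_reverse, support_cons,
        List.mem_cons] at hx hx'
      rcases hx' with rfl | rfl | hx'
      · rfl
      · exact absurd hx hf1
      · exact absurd hx' (hq1 x hx)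
  have hsupp : ∀ x ∈ D'.support, x = f ∨ x ∈ L.support := by
    intro x hx
    simp only [D', mem_support_append_iff, support_mapLe_eq_support, support_reverse,
      List.mem_reverse, support_cons, List.mem_cons] at hx
    rcases hx with hx | rfl | rfl | hx
    · exact Or.inr ((hmem x).2 (Or.inl hx))
    · exact Or.inr ((hmem _).2 (Or.inl L₁.start_mem_support))
    · exact Or.inl rfl
    · exact Or.inr ((hmem x).2 (Or.inr (Or.inr hx)))
  have hsupp2 : ∀ x ∈ (L₂.mapLe hFG).support, x = f ∨ x ∈ L.support := by
    intro x hx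
    rw [support_mapLe_eq_support] at hx
    exact Or.inr ((hmem x).2 (Or.inr (Or.inl hx)))
  have hfil : ∀ D : G.Walk p q, (∀ x ∈ D.support, x = f ∨ x ∈ L.support) →
      D.support.filter (· ∈ T) = [] := by
    intro D hD
    rw [List.filter_eq_nil_iff]
    intro x hx
    rcases hD x hx with rfl | hx'
    · simpa using hf
    · simpa using hL.notMem x hx'
  have heq := hT.eq_of_filter_eq h.left h.right h.disjoint
    ((isPath_mapLe hFG).2 h23.of_append_left) hD' (fun x hx => h.eq_left x (hsupp2 x hx))
    (fun x hx => h.eq_right x (hsupp2 x hx)) (fun x hx => h.eq_left x (hsupp x hx))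
    (fun x hx => h.eq_right x (hsupp x hx)) ((hfil _ hsupp2).trans (hfil _ hsupp).symm)
  have hfD : f ∈ D'.support := by simp [D']
  rw [← heq, support_mapLe_eq_support] at hfD
  exact hf2 hfD

lemma IsLoop.not_joinedIn_of_split (hT : IsTrackingSet G s t T) (hFG : F ≤ G)
    (hF : F.IsAcyclic) {a' b' b p q y z : V} {L' : F.Walk a' b'} (hL' : IsLoop G T f L')
    (hz : z ∈ L'.support) {A B C K M : Set V} (hA : G.JoinedIn A s p) (hB : G.JoinedIn B q t)
    (hC : G.JoinedIn C z y) (hK : G.JoinedIn K p y) (hM : G.JoinedIn M q b) (hb : G.Adj f b)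
    (hAB : ∀ x ∈ A, x ∉ B) (hKM : ∀ x ∈ K, x ∉ M) (hAM : ∀ x ∈ M, x ∈ A → x = p)
    (hBK : ∀ x ∈ K, x ∈ B → x = q) (hCM : ∀ x ∈ M, x ∈ C → x = y)
    (hBC : ∀ x ∈ B, x ∈ C → x = y)
    (hL'A : ∀ x ∈ L'.support, x ∉ A) (hL'B : ∀ x ∈ L'.support, x ∉ B)
    (hL'K : ∀ x ∈ L'.support, x ∉ K) (hL'M : ∀ x ∈ L'.support, x ∉ M)
    (hL'C : ∀ x ∈ L'.support, x ∈ C → x = z) (hfA : f ∉ A) (hfK : f ∉ K) (hfC : f ∉ C) :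
    False := by
  have hpK := hK.left_mem
  have hyK := hK.right_mem
  have hqM := hM.left_mem
  refine hL'.not_joinedIn hT.symm hFG hF hz ((hB.symm.trans hM).trans_adj hb.symm)
    ((hC.trans hK.symm).trans hA.symm) ?_ ?_ ?_
  · rintro x ((hx | hx) | rfl) ((hx' | hx') | hx') <;> grind
  · rintro x hx ((hx' | hx') | rfl)
    · exact hL'B x hx hx'
    · exact hL'M x hx hx'
    · exact hL'.apex_notMem hx
  · rintro x hx ((hx' | hx') | hx') <;> grind

lemma IsLoop.not_joinedIn_of_connector (hT : IsTrackingSet G s t T) (hFG : F ≤ G)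
    (hF : F.IsAcyclic) {a b a' b' p q y z : V} {L : F.Walk a b} {L' : F.Walk a' b'}
    (hL : IsLoop G T f L) (hL' : IsLoop G T f L') (hLL : ∀ x ∈ L.support, x ∉ L'.support)
    {A B C : Set V}
    (h : G.IsLinkage s t (insert f ({x | x ∈ L.support} ∪ {x | x ∈ L'.support})) A B p q)
    (hp : p ∈ L.support) (hq : q ∈ L.support) (hC : G.JoinedIn C z y) (hz : z ∈ L'.support)
    (hy : y ∈ L.support) (hfC : f ∉ C) (hLC : ∀ x ∈ L.support, x ∈ C → x = y)
    (hL'C : ∀ x ∈ L'.support, x ∈ C → x = z) (hAC : ∀ x ∈ A, x ∈ C → x = y)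
    (hBC : ∀ x ∈ B, x ∈ C → x = y) : False := by
  have hA : ∀ x ∈ L.support, x ∈ A → x = p := fun x hx => h.eq_left x (Or.inr (Or.inl hx))
  have hB : ∀ x ∈ L.support, x ∈ B → x = q := fun x hx => h.eq_right x (Or.inr (Or.inl hx))
  have hA' : ∀ x ∈ L'.support, x ∉ A := fun x hx hxA =>
    hLL p hp (h.eq_left x (Or.inr (Or.inr hx)) hxA ▸ hx)
  have hB' : ∀ x ∈ L'.support, x ∉ B := fun x hx hxB =>
    hLL q hq (h.eq_right x (Or.inr (Or.inr hx)) hxB ▸ hx)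
  have hfA : f ∉ A := fun hf => hL.apex_notMem (h.eq_left f (Or.inl rfl) hf ▸ hp)
  have hfB : f ∉ B := fun hf => hL.apex_notMem (h.eq_right f (Or.inl rfl) hf ▸ hq)
  have hfL := hL.apex_notMem
  obtain ⟨a₀, b₀, L₁, L₂, L₃, hpath, ha, hb, hmem⟩ :=
    hL.isPath.exists_split hL.adj_left hL.adj_right hp hq
  have h23 := hpath.of_append_right
  have h13 : ∀ x ∈ L₁.support, x ∉ L₃.support := by
    intro x hx hx3
    obtain rfl := hpath.eq_of_mem_append hx (by simp [hx3])
    exact h.ne (h23.eq_of_mem_append L₂.start_mem_support hx3)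
  have first : ∀ K : F.Walk p y, (∀ x ∈ K.support, x ∈ L.support) →
      (∀ x ∈ K.support, x ∉ L₃.support) → False := by
    intro K hKL hK
    refine hL'.not_joinedIn_of_split hT hFG hF hz h.left h.right hC (K.joinedIn.mapLe hFG)
      (L₃.joinedIn.mapLe hFG) hb h.disjoint hK (fun x hx => hA x ?_) (fun x hx => hB x (hKL x hx))
      (fun x hx => hLC x ?_) hBC hA' hB' (fun x hx hx' => hLL x (hKL x hx') hx)
      (fun x hx hx' => hLL x ?_ hx) hL'C hfA (fun hf => hfL (hKL f hf)) hfC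
    all_goals simp only [Set.mem_ofPred_eq] at *; grind
  have second : ∀ K : F.Walk q y, (∀ x ∈ K.support, x ∈ L.support) →
      (∀ x ∈ K.support, x ∉ L₁.support) → False := by
    intro K hKL hK
    refine hL'.not_joinedIn_of_split hT.symm hFG hF hz h.symm.left h.symm.right hC
      (K.joinedIn.mapLe hFG) (L₁.reverse.joinedIn.mapLe hFG) ha h.symm.disjoint ?_
      (fun x hx => hB x ?_) (fun x hx => hA x (hKL x hx))
      (fun x hx => hLC x ?_) hAC hB' hA' (fun x hx hx' => hLL x (hKL x hx') hx)
      (fun x hx hx' => hLL x ?_ hx) hL'C hfB (fun hf => hfL (hKL f hf)) hfC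
    all_goals simp only [Set.mem_ofPred_eq, support_reverse, List.mem_reverse] at *; grind
  by_cases hy3 : y ∈ L₃.support
  · refine second (L₃.takeUntil y hy3) (fun x hx => ?_) fun x hx hx1 => ?_
    · exact (hmem x).2 (Or.inr (Or.inr (L₃.support_takeUntil_subset_support hy3 hx)))
    · exact h13 x hx1 (L₃.support_takeUntil_subset_support hy3 hx)
  rcases (hmem y).1 hy with hy1 | hy2 | hy'
  · refine first (L₁.dropUntil y hy1).reverse (fun x hx => ?_) fun x hx hx3 => ?_ <;>
      rw [support_reverse, List.mem_reverse] at hx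
    · exact (hmem x).2 (Or.inl (L₁.support_dropUntil_subset_support hy1 hx))
    · exact h13 x (L₁.support_dropUntil_subset_support hy1 hx) hx3
  · refine first (L₂.takeUntil y hy2) (fun x hx => ?_) fun x hx hx3 => ?_
    · exact (hmem x).2 (Or.inr (Or.inl (L₂.support_takeUntil_subset_support hy2 hx)))
    · obtain rfl := h23.eq_of_mem_append (L₂.support_takeUntil_subset_support hy2 hx) hx3
      refine endpoint_notMem_support_takeUntil h23.of_append_left hy2 ?_ hx
      rintro rfl
      exact hy3 hx3
  · exact hy3 hy'

lemma IsLoop.not_joinedIn_of_mem (hT : IsTrackingSet G s t T) (hFG : F ≤ G)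
    (hF : F.IsAcyclic) {a b a' b' p q y z : V} {L : F.Walk a b} {L' : F.Walk a' b'}
    (hL : IsLoop G T f L) (hL' : IsLoop G T f L') (hLL : ∀ x ∈ L.support, x ∉ L'.support)
    {A B C : Set V}
    (h : G.IsLinkage s t (insert f ({x | x ∈ L.support} ∪ {x | x ∈ L'.support})) A B p q)
    (hp : p ∈ L.support) (hq : q ∈ L.support) (hC : G.JoinedIn C z y) (hz : z ∈ L'.support)
    (hy : y ∈ A) (hyL : y ∉ L.support) (hLC : ∀ x ∈ L.support, x ∈ C → x = y)
    (hBC : ∀ x ∈ B, x ∈ C → x = y) : False := by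
  have hyp : y ≠ p := fun e => hyL (e ▸ hp)
  refine hL'.not_joinedIn_of_disjoint hT hFG hF hL (fun x hx hx' => hLL x hx' hx) hz hq
    ((h.left_of_mem y hy hyp).trans hC.symm) h.right ?_ ?_ ?_
    (fun x hx => h.eq_right x (Or.inr (Or.inl hx))) ?_
  · rintro x (hx | hx) hxB
    · exact h.disjoint x hx.1 hxB
    · exact h.disjoint y hy (hBC x hxB hx ▸ hxB)
  · rintro x hx (hx' | hx')
    · exact hx'.2 (h.eq_left x (Or.inr (Or.inl hx)) hx'.1)
    · exact hyL (hLC x hx hx' ▸ hx)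
  · exact fun x hx hxB => hLL q hq (h.eq_right x (Or.inr (Or.inr hx)) hxB ▸ hx)
  · exact fun hf => hL.apex_notMem (h.eq_right f (Or.inl rfl) hf ▸ hq)

lemma IsLoop.not_isLinkage (hT : IsTrackingSet G s t T) (hFG : F ≤ G)
    (hpart : ∀ v : V, ∃ p : G.Path s t, v ∈ p.1.support)
    (hF : F.IsAcyclic) {a b a' b' p q : V} {L : F.Walk a b} {L' : F.Walk a' b'}
    (hL : IsLoop G T f L) (hL' : IsLoop G T f L') (hLL : ∀ x ∈ L.support, x ∉ L'.support)
    {A B : Set V}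
    (h : G.IsLinkage s t (insert f ({x | x ∈ L.support} ∪ {x | x ∈ L'.support})) A B p q)
    (hp : p ∈ L.support) (hq : q ∈ L.support) : False := by
  have hX : ∃ e ∈ A ∪ B, ∃ X : G.Walk a' e, f ∉ X.support := by
    obtain ⟨Q, hQ⟩ := hpart a'
    obtain ⟨Q₁, Q₂, h1, h2, hQe⟩ := Q.2.mem_support_iff_exists_append.1 hQ
    by_cases hf : f ∈ Q₂.support
    · refine ⟨s, Or.inl h.left.left_mem, Q₁.reverse, fun hf' => ?_⟩
      rw [support_reverse, List.mem_reverse] at hf'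
      have hpath := Q.2
      rw [hQe] at hpath
      exact hL'.adj_left.ne (hpath.eq_of_mem_append hf' hf)
    · exact ⟨t, Or.inr h.right.right_mem, Q₂, hf⟩
  obtain ⟨e, he, X, hfX⟩ := hX
  obtain ⟨y, hy, X₁, X₂, rfl, hX₁⟩ := X.exists_append_first_mem (H := A ∪ B ∪ {x | x ∈ L.support})
    X.end_mem_support (Or.inl he)
  obtain ⟨z, hz, R, R', hR, hRz⟩ := X₁.reverse.exists_append_first_mem
    (H := {x | x ∈ L'.support}) (x := a') (by simp) L'.start_mem_support
  have hRX : ∀ x ∈ R.support, x ∈ X₁.support := by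
    intro x hx
    rw [← List.mem_reverse, ← support_reverse, hR, mem_support_append_iff]
    exact Or.inl hx
  have hC := R.joinedIn.symm
  have hLC : ∀ x ∈ L.support, x ∈ {x | x ∈ R.support} → x = y :=
    fun x hx hxR => hX₁ x (hRX x hxR) (Or.inr hx)
  have hAC : ∀ x ∈ A, x ∈ {x | x ∈ R.support} → x = y :=
    fun x hx hxR => hX₁ x (hRX x hxR) (Or.inl (Or.inl hx))
  have hBC : ∀ x ∈ B, x ∈ {x | x ∈ R.support} → x = y :=
    fun x hx hxR => hX₁ x (hRX x hxR) (Or.inl (Or.inr hx))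
  by_cases hyL : y ∈ L.support
  · refine hL.not_joinedIn_of_connector hT hFG hF hL' hLL h hp hq hC hz hyL (fun hf => hfX ?_)
      hLC (fun x hx hxR => hRz x hxR hx) hAC hBC
    rw [mem_support_append_iff]
    exact Or.inl (hRX f hf)
  rcases hy with (hyA | hyB) | hy
  · exact hL.not_joinedIn_of_mem hT hFG hF hL' hLL h hp hq hC hz hyA hyL hLC hBC
  · exact hL.not_joinedIn_of_mem hT.symm hFG hF hL' hLL h.symm hq hp hC hz hyB hyL hLC hAC
  · exact hyL hy

/-- Two disjoint loops with a common apex contain a tracker other than this apex. -/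
lemma IsLoop.not_disjoint (hT : IsTrackingSet G s t T) (hFG : F ≤ G)
    (hpartV : ∀ v : V, ∃ p : G.Path s t, v ∈ p.1.support)
    (hpartE : ∀ e ∈ G.edgeSet, ∃ p : G.Path s t, e ∈ p.1.edges)
    (hF : F.IsAcyclic) {a b a' b' : V} {L : F.Walk a b} {L' : F.Walk a' b'}
    (hL : IsLoop G T f L) (hL' : IsLoop G T f L') (hLL : ∀ x ∈ L.support, x ∉ L'.support) :
    False := by
  obtain ⟨P, hP⟩ := hpartE s(f, a) hL.adj_left
  have hLL' : ∀ x ∈ L'.support, x ∉ L.support := fun x hx hx' => hLL x hx' hx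
  obtain ⟨A, B, p, q, h⟩ := exists_isLinkage P.2
    (H := insert f ({x | x ∈ L.support} ∪ {x | x ∈ L'.support}))
    (P.1.fst_mem_support_of_mem_edges hP) (P.1.snd_mem_support_of_mem_edges hP)
    (Or.inl rfl) (Or.inr (Or.inl L.start_mem_support)) hL.adj_left.ne
  have h' := h
  rw [Set.union_comm] at h'
  have hend : ∀ {s t p q A B}, IsTrackingSet G s t T →
      G.IsLinkage s t (insert f ({x | x ∈ L.support} ∪ {x | x ∈ L'.support})) A B p q →
      p ≠ f := by
    rintro s t p q A B hT h rfl
    rcases h.right_mem.resolve_left h.ne.symm with hq | hq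
    · refine hL.not_joinedIn hT hFG hF hq h.left h.right h.disjoint (fun x hx hxA => ?_)
        fun x hx => h.eq_right x (Or.inr (Or.inl hx))
      exact hL.apex_notMem (h.eq_left x (Or.inr (Or.inl hx)) hxA ▸ hx)
    · refine hL'.not_joinedIn hT hFG hF hq h.left h.right h.disjoint (fun x hx hxA => ?_)
        fun x hx => h.eq_right x (Or.inr (Or.inr hx))
      exact hL'.apex_notMem (h.eq_left x (Or.inr (Or.inr hx)) hxA ▸ hx)
  have hpf := hend hT h
  have hqf := hend hT.symm h.symm
  have hfB : f ∉ B := fun hf => hqf (h.eq_right f (Or.inl rfl) hf).symm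
  rcases h.left_mem.resolve_left hpf with hp | hp <;>
    rcases h.right_mem.resolve_left hqf with hq | hq
  · exact hL.not_isLinkage hT hFG hpartV hF hL' hLL h hp hq
  · refine hL.not_joinedIn_of_disjoint hT hFG hF hL' hLL hp hq h.left h.right h.disjoint ?_ ?_
      (fun x hx => h.eq_right x (Or.inr (Or.inr hx))) hfB
    · exact fun x hx hxA => hLL p hp (h.eq_left x (Or.inr (Or.inr hx)) hxA ▸ hx)
    · exact fun x hx hxB => hLL' q hq (h.eq_right x (Or.inr (Or.inl hx)) hxB ▸ hx)
  · refine hL'.not_joinedIn_of_disjoint hT hFG hF hL hLL' hp hq h.left h.right h.disjoint ?_ ?_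
      (fun x hx => h.eq_right x (Or.inr (Or.inl hx))) hfB
    · exact fun x hx hxA => hLL' p hp (h.eq_left x (Or.inr (Or.inl hx)) hxA ▸ hx)
    · exact fun x hx hxB => hLL q hq (h.eq_right x (Or.inr (Or.inr hx)) hxB ▸ hx)
  · exact hL'.not_isLinkage hT hFG hpartV hF hL hLL' h' hp hq

lemma IsLinkage.card_le_of_forall_notMem (hT : IsTrackingSet G s t T) (hFG : F ≤ G)
    (hF : F.IsAcyclic) {N N' U : Finset V} (hadj : ∀ v ∈ N, G.Adj f v)
    (hreach : ∀ v ∈ N, ∀ w ∈ F.pathHull N, F.Reachable v w) (hf : f ∉ F.pathHull N)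
    {A B : Set V} {p q : V} (h : G.IsLinkage s t (insert f (F.pathHull N)) A B p q)
    (hp : p ∈ F.pathHull N) (hq : q ∈ F.pathHull N) (hN' : N' ⊆ N)
    (hpr : ∀ v ∈ N', ∀ r : F.Walk v q, r.IsPath → p ∉ r.support)
    (hU : ∀ v ∈ N', ∀ r : F.Walk v q, r.IsPath → ∀ x ∈ r.support, x ∈ T → x ∈ U) :
    N'.card ≤ U.card + 1 := by
  rcases N'.eq_empty_or_nonempty with rfl | ⟨v₀, hv₀⟩
  · simp
  obtain ⟨r, hr⟩ := ((hreach v₀ (hN' hv₀) p hp).symm.trans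
    (hreach v₀ (hN' hv₀) q hq)).exists_isPath
  obtain ⟨l, hl, r', hr', hr'M⟩ := exists_append_isPath_of_mem_pathHull hF hp hr
  refine hT.card_le_of_forall_path hFG hF
    ((h.left.trans (r'.reverse.joinedIn.mapLe hFG)).trans_adj (hadj l hl).symm) h.right ?_
    fun v hv => ⟨hadj v (hN' hv), ?_⟩
  · rintro x ((hx | hx) | rfl) hxB
    · exact h.disjoint x hx hxB
    · rw [Set.mem_ofPred_eq, support_reverse, List.mem_reverse] at hx
      obtain rfl := h.eq_right x (Or.inr (hr'M x hx)) hxB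
      exact h.ne (hr'.eq_of_mem_append hx r.end_mem_support).symm
    · exact hf (h.eq_right x (Or.inl rfl) hxB ▸ hq)
  · obtain ⟨R, hR⟩ := (hreach v (hN' hv) q hq).exists_isPath
    have hRM := hR.mem_pathHull hF (hN' hv) hq
    refine ⟨R, hR, fun x hx => ⟨?_, h.eq_right x (Or.inr (hRM x hx)), hU v hv R hR x hx⟩⟩
    rintro ((hxA | hxr) | rfl)
    · exact hpr v hv R hR (h.eq_left x (Or.inr (hRM x hx)) hxA ▸ hx)
    · rw [Set.mem_ofPred_eq, support_reverse, List.mem_reverse] at hxr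
      obtain ⟨R₁, R₂, -, h2, rfl⟩ := hR.mem_support_iff_exists_append.1 hx
      obtain ⟨r₁, r₂, -, h2', rfl⟩ := hr'.of_append_left.mem_support_iff_exists_append.1 hxr
      rw [← append_assoc] at hr'
      have := hF.walk_eq h2 hr'.of_append_right
      exact hpr v hv _ hR (by simp [this])
    · exact hf (hRM x hx)

/-- If the neighbours `N` of `f` lie in a single tree of the forest `F`, then this tree contains
at least `#N - 2` trackers. -/
lemma _root_.IsTrackingSet.card_le_card_add_two (hT : IsTrackingSet G s t T) (hFG : F ≤ G)
    (hpartE : ∀ e ∈ G.edgeSet, ∃ p : G.Path s t, e ∈ p.1.edges)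
    (hF : F.IsAcyclic) {N U : Finset V} (hadj : ∀ v ∈ N, G.Adj f v)
    (hN : ∀ v ∈ N, ∀ w ∈ N, F.Reachable v w) (hf : ∀ v ∈ N, ¬ F.Reachable v f)
    (hU : ∀ v ∈ N, ∀ x ∈ T, F.Reachable v x → x ∈ U) : N.card ≤ U.card + 2 := by
  classical
  rcases N.eq_empty_or_nonempty with rfl | ⟨v₀, hv₀⟩
  · simp
  have hreach : ∀ v ∈ N, ∀ w ∈ F.pathHull N, F.Reachable v w := by
    rintro v hv w ⟨l, hl, l', hl', r, hr, hw⟩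
    exact (hN v hv l hl).trans ⟨r.takeUntil w hw⟩
  have hfM : f ∉ F.pathHull N := fun h => hf v₀ hv₀ (hreach v₀ hv₀ f h)
  have hvM : v₀ ∈ F.pathHull N := ⟨v₀, hv₀, v₀, hv₀, nil, IsPath.nil, by simp⟩
  obtain ⟨P, hP⟩ := hpartE s(f, v₀) (hadj v₀ hv₀)
  obtain ⟨A, B, p, q, h⟩ := exists_isLinkage P.2 (H := insert f (F.pathHull N))
    (P.1.fst_mem_support_of_mem_edges hP) (P.1.snd_mem_support_of_mem_edges hP)
    (Or.inl rfl) (Or.inr hvM) (hadj v₀ hv₀).ne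
  have hend : ∀ {s t p q A B}, IsTrackingSet G s t T →
      G.IsLinkage s t (insert f (F.pathHull N)) A B p q → p = f → N.card ≤ U.card + 2 := by
    rintro s t p q A B hT h rfl
    have hq : q ∈ F.pathHull N := h.right_mem.resolve_left h.ne.symm
    refine (hT.card_le_of_forall_path hFG hF h.left h.right h.disjoint (U := U)
      fun v hv => ⟨hadj v hv, ?_⟩).trans (by omega)
    obtain ⟨r, hr⟩ := (hreach v hv q hq).exists_isPath
    have hrM := hr.mem_pathHull hF hv hq
    refine ⟨r, hr, fun x hx => ⟨fun hxA => ?_, h.eq_right x (Or.inr (hrM x hx)), fun hxT =>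
      hU v hv x hxT ⟨r.takeUntil x hx⟩⟩⟩
    exact hfM (h.eq_left x (Or.inr (hrM x hx)) hxA ▸ hrM x hx)
  by_cases hpf : p = f
  · exact hend hT h hpf
  by_cases hqf : q = f
  · exact hend hT.symm h.symm hqf
  have hp : p ∈ F.pathHull N := h.left_mem.resolve_left hpf
  have hq : q ∈ F.pathHull N := h.right_mem.resolve_left hqf
  let D : V → Prop := fun x => ∃ r : F.Walk x q, r.IsPath ∧ p ∈ r.support
  have hout := h.card_le_of_forall_notMem hT hFG hF hadj hreach hfM hp hq
    (N' := N.filter fun v => ¬ D v) (U := U.filter fun v => ¬ D v) (Finset.filter_subset _ _)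
    (fun v hv r hr hpr => (Finset.mem_filter.1 hv).2 ⟨r, hr, hpr⟩) (by
      intro v hv r hr x hx hxT
      rw [Finset.mem_filter] at hv ⊢
      refine ⟨hU v hv.1 x hxT ⟨r.takeUntil x hx⟩, ?_⟩
      rintro ⟨R, hR, hpR⟩
      obtain ⟨r₁, r₂, -, h2, rfl⟩ := hr.mem_support_iff_exists_append.1 hx
      obtain rfl := hF.walk_eq hR h2
      exact hv.2 ⟨_, hr, by simp [hpR]⟩)
  have hin := h.symm.card_le_of_forall_notMem hT.symm hFG hF hadj hreach hfM hq hp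
    (N' := N.filter D) (U := U.filter D) (Finset.filter_subset _ _) (by
      intro v hv r hr hqr
      obtain ⟨R, hR, hpR⟩ := (Finset.mem_filter.1 hv).2
      obtain ⟨R₁, R₂, h1, -, rfl⟩ := hR.mem_support_iff_exists_append.1 hpR
      obtain rfl := hF.walk_eq hr h1
      exact h.ne (hR.eq_of_mem_append hqr R₂.end_mem_support).symm) (by
      intro v hv r hr x hx hxT
      rw [Finset.mem_filter] at hv ⊢
      refine ⟨hU v hv.1 x hxT ⟨r.takeUntil x hx⟩, ?_⟩
      obtain ⟨R, hR, hpR⟩ := hv.2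
      obtain ⟨R₁, R₂, h1, -, rfl⟩ := hR.mem_support_iff_exists_append.1 hpR
      obtain rfl := hF.walk_eq hr h1
      obtain ⟨r₁, r₂, -, -, rfl⟩ := hr.mem_support_iff_exists_append.1 hx
      rw [← append_assoc] at hR
      exact ⟨_, hR.of_append_right, by simp⟩)
  have h1 := Finset.card_filter_add_card_filter_not (s := N) D
  have h2 := Finset.card_filter_add_card_filter_not (s := U) D
  omega

/-- In a forest avoiding `f`, the number of neighbors of `f` sharing their tree with another
neighbor of `f` is at most three times the number of trackers. -/
lemma _root_.IsTrackingSet.card_le_three_mul (hT : IsTrackingSet G s t T) (hFG : F ≤ G)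
    (hpartV : ∀ v : V, ∃ p : G.Path s t, v ∈ p.1.support)
    (hpartE : ∀ e ∈ G.edgeSet, ∃ p : G.Path s t, e ∈ p.1.edges)
    (hF : F.IsAcyclic) (hf : ∀ v, F.Reachable v f → v = f) {N : Finset V}
    (hN : ∀ v ∈ N, G.Adj f v ∧ ∃ u, u ≠ v ∧ G.Adj f u ∧ F.Reachable v u) :
    N.card ≤ 3 * T.card := by
  classical
  let C := N.image F.connectedComponentMk
  have hfN : ∀ v ∈ N, ¬ F.Reachable v f := fun v hv h => (hN v hv).1.ne (hf v h).symm
  have hfC : F.connectedComponentMk f ∉ C := by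
    intro h
    obtain ⟨v, hv, hvf⟩ := Finset.mem_image.1 h
    exact hfN v hv (ConnectedComponent.exact hvf)
  have hrep : ∀ c ∈ C, ∃ x ∈ T, F.connectedComponentMk x = c ∨ x = f ∧
      ∃ (a b : V) (L : F.Walk a b), IsLoop G T f L ∧ F.connectedComponentMk a = c := by
    intro c hc
    obtain ⟨v, hv, rfl⟩ := Finset.mem_image.1 hc
    by_cases hx : ∃ x ∈ T, F.connectedComponentMk x = F.connectedComponentMk v
    · obtain ⟨x, hxT, hx⟩ := hx
      exact ⟨x, hxT, Or.inl hx⟩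
    obtain ⟨hfv, u, huv, hfu, hvu⟩ := hN v hv
    obtain ⟨L, hL⟩ := hvu.exists_isPath
    have hloop : IsLoop G T f L := ⟨hL, huv.symm, hfv, hfu,
      fun x hxL hxT => hx ⟨x, hxT, ConnectedComponent.sound ⟨(L.takeUntil x hxL).reverse⟩⟩,
      fun h => hfN v hv ⟨L.takeUntil f h⟩⟩
    obtain ⟨P, hP⟩ := hpartE s(f, v) hfv
    obtain ⟨A, B, p, q, h⟩ := exists_isLinkage P.2 (H := insert f {x | x ∈ L.support})
      (P.1.fst_mem_support_of_mem_edges hP) (P.1.snd_mem_support_of_mem_edges hP)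
      (Or.inl rfl) (Or.inr L.start_mem_support) hfv.ne
    exact ⟨f, hloop.apex_mem hT hFG hF h, Or.inr ⟨rfl, v, u, L, hloop, rfl⟩⟩
  have : Nonempty V := ⟨f⟩
  choose! g hgT hg using hrep
  have hinj : Set.InjOn g (C : Set F.ConnectedComponent) := by
    intro c hc c' hc' h
    rcases hg c hc with hgc | ⟨hgc, a, b, L, hL, hac⟩ <;>
      rcases hg c' hc' with hgc' | ⟨hgc', a', b', L', hL', hac'⟩
    · rw [← hgc, ← hgc', h]
    · rw [h, hgc'] at hgc
      exact absurd (hgc ▸ hc) hfC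
    · rw [← h, hgc] at hgc'
      exact absurd (hgc' ▸ hc') hfC
    · by_contra hne
      refine hL.not_disjoint hT hFG hpartV hpartE hF hL' fun x hx hx' => hne ?_
      rw [← hac, ← hac']
      exact ConnectedComponent.sound
        (Reachable.trans ⟨L.takeUntil x hx⟩ ⟨(L'.takeUntil x hx').reverse⟩)
  have hC : C.card ≤ T.card := Finset.card_le_card_of_injOn g hgT hinj
  have hfib : ∀ c ∈ C, (N.filter (F.connectedComponentMk · = c)).card ≤
      (T.filter (F.connectedComponentMk · = c)).card + 2 := by
    intro c _
    refine hT.card_le_card_add_two hFG hpartE hF (f := f) (fun v hv => ?_) (fun v hv w hw => ?_)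
      (fun v hv => ?_) fun v hv x hxT hvx => ?_
    · exact (hN v (Finset.mem_filter.1 hv).1).1
    · exact ConnectedComponent.exact
        ((Finset.mem_filter.1 hv).2.trans (Finset.mem_filter.1 hw).2.symm)
    · exact hfN v (Finset.mem_filter.1 hv).1
    · exact Finset.mem_filter.2
        ⟨hxT, (ConnectedComponent.sound hvx.symm).trans (Finset.mem_filter.1 hv).2⟩
  calc N.card = ∑ c ∈ C, (N.filter (F.connectedComponentMk · = c)).card :=
        Finset.card_eq_sum_card_image _ N
    _ ≤ ∑ c ∈ C, ((T.filter (F.connectedComponentMk · = c)).card + 2) :=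
        Finset.sum_le_sum hfib
    _ = ∑ c ∈ C, (T.filter (F.connectedComponentMk · = c)).card + C.card * 2 := by
        rw [Finset.sum_add_distrib, Finset.sum_const, smul_eq_mul]
    _ ≤ T.card + T.card * 2 := by
        gcongr
        exact (Finset.sum_card_fiberwise_eq_card_filter T C F.connectedComponentMk).trans_le
          (Finset.card_filter_le _ _)
    _ = 3 * T.card := by ring

end SimpleGraph

/-- if `S` is a feedback vertex set of size at most `2k` and `G`
has a tracking set of size at most `k`, then for every `f ∈ S` the number of
vertices of the forest `G - S` that are adjacent to `f` and share `f` as a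
neighbor with another vertex of the same tree of `G - S` (thereby forming
tree-sink structures with sink `f`) is at most `3k`. -/
theorem sink_vertex_bound {V : Type*} [Fintype V] [DecidableEq V]
    (G : SimpleGraph V) (s t : V) (k : ℕ) (S : Finset V)
    (hpartV : ∀ v : V, ∃ p : G.Path s t, v ∈ p.1.support)
    (hpartE : ∀ e ∈ G.edgeSet, ∃ p : G.Path s t, e ∈ p.1.edges)
    (hfvs : (G.induce {v : V | v ∉ S}).IsAcyclic)
    (hS : S.card ≤ 2 * k)
    (hTk : ∃ T : Finset V, IsTrackingSet G s t T ∧ T.card ≤ k) :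
    ∀ f ∈ S,
      {v : V | v ∉ S ∧ G.Adj f v ∧ ∃ u : V, u ≠ v ∧ G.Adj f u ∧
        ∃ p : G.Walk v u, ∀ w ∈ p.support, w ∉ S}.ncard ≤ 3 * k := by
  classical
  intro f hfS
  obtain ⟨T, hT, hTk⟩ := hTk
  set F := (G.induce {v : V | v ∉ S}).spanningCoe with hFdef
  have hadj : ∀ {a b : V}, F.Adj a b ↔ G.Adj a b ∧ a ∉ S ∧ b ∉ S := by
    intro a b
    simp [hFdef]
  have hisol : ∀ v, F.Reachable v f → v = f := by
    rintro v ⟨w⟩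
    cases w.reverse with
    | nil => rfl
    | cons h _ => exact absurd hfS (hadj.1 h).2.1
  have hreach : ∀ {a b : V} (w : G.Walk a b), (∀ x ∈ w.support, x ∉ S) → F.Reachable a b := by
    intro a b w hw
    induction w with
    | nil => exact .rfl
    | cons h w ih =>
      simp only [SimpleGraph.Walk.support_cons, List.forall_mem_cons] at hw
      exact (hadj.2 ⟨h, hw.1, hw.2 _ w.start_mem_support⟩).reachable.trans (ih hw.2)
  rw [Set.ncard_eq_toFinset_card']
  refine (hT.card_le_three_mul (G.spanningCoe_induce_le _) hpartV hpartE
    (SimpleGraph.isAcyclic_spanningCoe_induce hfvs) hisol fun v hv => ?_).trans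
    (Nat.mul_le_mul_left 3 hTk)
  obtain ⟨-, hfv, u, huv, hfu, p, hp⟩ := Set.mem_toFinset.1 hv
  exact ⟨hfv, u, huv, hfu, hreach p hp⟩
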